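/- Let T be a tree on n ≥ 5 vertices that is not a star. Then det(ε(T)) = 0, i.e., the eccentricity matrix of T is singular. -/

import Mathlib

open Finset SimpleGraph

variable {V : Type*}

/-- The eccentricity of a vertex: the largest distance to another vertex. -/
noncomputable def ecc [Fintype V] (G : SimpleGraph V) (u : V) : ℕ :=
  Finset.univ.sup fun v => G.dist u v

/-- The diameter of a graph: the largest eccentricity. -/
noncomputable def gdiam [Fintype V] (G : SimpleGraph V) : ℕ :=
  Finset.univ.sup fun u => ecc G u

/-- The eccentricity matrix: keep the distance `d(u,v)` if it equals
`min (e u) (e v)`, and put `0` otherwise. -/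
noncomputable def eccMatrix [Fintype V] (G : SimpleGraph V) : Matrix V V ℝ :=
  Matrix.of fun u v =>
    if G.dist u v = min (ecc G u) (ecc G v) then (G.dist u v : ℝ) else 0

/-- The distance matrix of a graph. -/
noncomputable def distMatrix [Fintype V] (G : SimpleGraph V) : Matrix V V ℝ :=
  Matrix.of fun u v => (G.dist u v : ℝ)

theorem SimpleGraph.IsTree.eq_of_adj_of_dist_add_one {G : SimpleGraph V} (hG : G.IsTree)
    {c a b v : V} (hca : G.Adj c a) (hcb : G.Adj c b)
    (ha : G.dist a v + 1 = G.dist c v) (hb : G.dist b v + 1 = G.dist c v) : a = b := by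
  obtain ⟨p, hp⟩ := hG.connected.exists_walk_length_eq_dist a v
  obtain ⟨q, hq⟩ := hG.connected.exists_walk_length_eq_dist b v
  have hp' : (Walk.cons hca p).IsPath := Walk.isPath_of_length_eq_dist _ (by simp; omega)
  have hq' : (Walk.cons hcb q).IsPath := Walk.isPath_of_length_eq_dist _ (by simp; omega)
  have h := (hG.existsUnique_path c v).unique hp' hq'
  simpa using congrArg Walk.snd h

theorem SimpleGraph.Connected.exists_adj_dist_add_one {G : SimpleGraph V} (hG : G.Connected)
    {u v : V} (h : u ≠ v) : ∃ a, G.Adj u a ∧ G.dist a v + 1 = G.dist u v := by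
  obtain ⟨p, hp⟩ := hG.exists_walk_length_eq_dist u v
  cases p with
  | nil => exact absurd rfl h
  | @cons _ a _ hua q =>
    refine ⟨a, hua, ?_⟩
    have h1 := dist_le q
    have h2 := hG.dist_triangle (u := u) (v := a) (w := v)
    rw [dist_eq_one_iff_adj.2 hua] at h2
    simp only [Walk.length_cons] at hp
    omega

theorem SimpleGraph.IsTree.dist_eq_add_of_opposite_sides {G : SimpleGraph V} (hG : G.IsTree)
    {x y u w : V} (hxy : G.Adj x y) (hu : G.dist u y = G.dist u x + 1)
    (hw : G.dist w x = G.dist w y + 1) : G.dist u w = G.dist u x + 1 + G.dist y w := by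
  induction hn : G.dist u x using Nat.strong_induction_on generalizing u with
  | _ n ih =>
    have hyw : G.dist w y = G.dist y w := dist_comm
    by_cases hux : u = x
    · subst hux
      rw [dist_self] at hn
      rw [dist_comm, hw, dist_comm]
      omega
    obtain ⟨u', huu', hu'⟩ := hG.connected.exists_adj_dist_add_one hux
    have h1 := dist_eq_one_iff_adj.2 huu'
    have h2 := dist_eq_one_iff_adj.2 hxy
    have h3 := hG.connected.dist_triangle (u := u) (v := u') (w := y)
    have h4 := hG.connected.dist_triangle (u := u') (v := x) (w := y)
    have hu'y : G.dist u' y = G.dist u' x + 1 := by omega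
    have ih' := ih _ (by omega) hu'y rfl
    have h5 := hG.dist_eq_dist_add_one_of_adj w huu'
    rw [dist_comm (u := w), dist_comm (u := w)] at h5
    rcases h5 with h5 | h5
    · omega
    exfalso
    by_cases hux' : u' = x
    · subst hux'
      have : u = y := hG.eq_of_adj_of_dist_add_one (v := w) huu'.symm hxy h5.symm
        (by rw [dist_comm (u := u'), hw, dist_comm])
      subst this
      simp at hu
    · obtain ⟨u'', hadj, hu''⟩ := hG.connected.exists_adj_dist_add_one hux'
      have h1' := dist_eq_one_iff_adj.2 hadj
      have h3' := hG.connected.dist_triangle (u := u') (v := u'') (w := y)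
      have h4' := hG.connected.dist_triangle (u := u'') (v := x) (w := y)
      have ih'' := ih (G.dist u'' x) (by omega) (u := u'') (by omega) rfl
      have : u = u'' := hG.eq_of_adj_of_dist_add_one (v := w) huu'.symm hadj h5.symm (by omega)
      subst this
      omega

theorem dist_le_ecc [Fintype V] (G : SimpleGraph V) (u v : V) : G.dist u v ≤ ecc G u :=
  Finset.le_sup (f := fun v => G.dist u v) (Finset.mem_univ v)

theorem exists_dist_eq_ecc [Fintype V] (G : SimpleGraph V) (u : V) :
    ∃ v, G.dist u v = ecc G u := by
  obtain ⟨v, -, hv⟩ := Finset.exists_mem_eq_sup Finset.univ ⟨u, Finset.mem_univ u⟩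
    (fun v => G.dist u v)
  exact ⟨v, hv.symm⟩

theorem ecc_le_ecc_add_one_of_adj [Fintype V] {G : SimpleGraph V} (hG : G.Connected) {u v : V}
    (h : G.Adj u v) : ecc G u ≤ ecc G v + 1 := by
  obtain ⟨w, hw⟩ := exists_dist_eq_ecc G u
  have h1 := hG.dist_triangle (u := u) (v := v) (w := w)
  have h2 := dist_le_ecc G v w
  rw [dist_eq_one_iff_adj.2 h] at h1
  omega

theorem adj_of_ecc_minimal [Fintype V] {G : SimpleGraph V} (hG : G.IsTree) {x y : V}
    (hne : x ≠ y) (hx : ∀ v, ecc G x ≤ ecc G v) (hy : ∀ v, ecc G y ≤ ecc G v) : G.Adj x y := by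
  obtain ⟨z, hxz, hz⟩ := hG.connected.exists_adj_dist_add_one hne
  by_cases hzy : z = y
  · exact hzy ▸ hxz
  exfalso
  have hpos := hG.connected.pos_dist_of_ne hzy
  obtain ⟨v, hv⟩ := exists_dist_eq_ecc G z
  have hxv := dist_le_ecc G x v
  have hyv := dist_le_ecc G y v
  have hxz' := hx z
  have hyz' := hy z
  have h1 : G.dist v x = G.dist x v := dist_comm
  have h2 : G.dist v z = G.dist z v := dist_comm
  have h3 : G.dist v y = G.dist y v := dist_comm
  have h4 : G.dist y x = G.dist x y := dist_comm
  have h5 : G.dist y z = G.dist z y := dist_comm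
  rcases hG.dist_eq_dist_add_one_of_adj v hxz with h | h
  · omega
  · have := hG.dist_eq_add_of_opposite_sides hxz h (w := y) (by omega)
    omega

/-- If the vertex of minimal eccentricity is unique, the rows of its neighbours, rescaled, add up
to a multiple of its own row. -/
theorem eccMatrix_det_eq_zero_of_unique_center [Fintype V] [DecidableEq V] {G : SimpleGraph V}
    (hG : G.IsTree) {c : V} (hr : 2 ≤ ecc G c) (hc : ∀ v, v ≠ c → ecc G c < ecc G v) :
    (eccMatrix G).det = 0 := by
  classical
  set r := ecc G c with hrdef
  obtain ⟨far, hfar⟩ := exists_dist_eq_ecc G c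
  have hfarc : c ≠ far := by
    rintro rfl
    simp at hfar
    omega
  obtain ⟨a₀, ha₀, -⟩ := hG.connected.exists_adj_dist_add_one hfarc
  have hrow_c (v : V) : eccMatrix G c v = if G.dist c v = r then (r : ℝ) else 0 := by
    have hmin : min (ecc G c) (ecc G v) = r := by
      by_cases hv : v = c
      · simp [hv, hrdef]
      · exact min_eq_left (hc v hv).le
    simp only [eccMatrix, Matrix.of_apply, hmin]
    split_ifs with h <;> simp [h]
  have hrow (a : V) (ha : G.Adj c a) (v : V) :
      eccMatrix G a v = if G.dist a v = r + 1 then (r + 1 : ℝ) else 0 := by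
    have hea : ecc G a = r + 1 :=
      le_antisymm (ecc_le_ecc_add_one_of_adj hG.connected ha.symm) (hc a ha.ne')
    by_cases hv : v = c
    · have h1 := dist_eq_one_iff_adj.2 ha.symm
      subst hv
      simp only [eccMatrix, Matrix.of_apply, hea, h1]
      rw [if_neg (by omega), if_neg (by omega)]
    · have := hc v hv
      have hmin : min (ecc G a) (ecc G v) = r + 1 := by omega
      simp only [eccMatrix, Matrix.of_apply, hmin]
      split_ifs with h <;> simp [h]
  have hsum (v : V) : (∑ a with G.Adj c a, if G.dist a v = r + 1 then (1 : ℝ) else 0) =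
      if G.dist c v = r then (#{a | G.Adj c a} : ℝ) - 1 else 0 := by
    have hle := dist_le_ecc G c v
    have hstep (a : V) (ha : G.Adj c a) :
        G.dist c v = G.dist a v + 1 ∨ G.dist a v = G.dist c v + 1 := by
      simpa [dist_comm] using hG.dist_eq_dist_add_one_of_adj v ha
    split_ifs with hv
    · have hcv : c ≠ v := by
        rintro rfl
        simp at hv
        omega
      obtain ⟨b, hb, hbv⟩ := hG.connected.exists_adj_dist_add_one hcv
      have hmem : b ∈ Finset.univ.filter (fun a => G.Adj c a) := by simpa using hb
      rw [← Finset.add_sum_erase _ _ hmem, if_neg (by omega), zero_add,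
        Finset.sum_congr rfl (g := fun _ => (1 : ℝ)), Finset.sum_const, nsmul_one,
        Finset.card_erase_of_mem hmem, Nat.cast_pred (Finset.card_pos.2 ⟨b, hmem⟩)]
      intro a ha
      simp only [Finset.mem_erase, Finset.mem_filter_univ] at ha
      refine if_pos ?_
      rcases hstep a ha.2 with h | h
      · exact absurd (hG.eq_of_adj_of_dist_add_one ha.2 hb h.symm hbv) ha.1
      · omega
    · refine Finset.sum_eq_zero fun a ha => if_neg ?_
      have := hstep a (by simpa using ha)
      omega
  have hr0 : (r : ℝ) ≠ 0 := by
    have : r ≠ 0 := by omega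
    exact_mod_cast this
  let x : V → ℝ := fun u => (if G.Adj c u then (r : ℝ) else 0) -
    if u = c then (r + 1 : ℝ) * (#{a | G.Adj c a} - 1) else 0
  rw [← Matrix.exists_vecMul_eq_zero_iff]
  refine ⟨x, fun hx => ?_, ?_⟩
  · have := congrFun hx a₀
    simp [x, ha₀, ha₀.ne', hr0] at this
  · ext v
    have hrewrite : (∑ a with G.Adj c a, (r : ℝ) * eccMatrix G a v) =
        r * (r + 1) * ∑ a with G.Adj c a, if G.dist a v = r + 1 then (1 : ℝ) else 0 := by
      rw [Finset.mul_sum]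
      refine Finset.sum_congr rfl fun a ha => ?_
      rw [hrow a (by simpa using ha)]
      split_ifs <;> ring
    simp only [x, Matrix.vecMul, dotProduct, sub_mul, Finset.sum_sub_distrib, ite_mul, zero_mul,
      Finset.sum_ite_eq', Finset.mem_univ, if_true, ← Finset.sum_filter, Pi.zero_apply]
    rw [hrewrite, hsum, hrow_c]
    split_ifs <;> ring

theorem Matrix.det_eq_zero_of_smul_row_eq {n : Type*} [Fintype n] [DecidableEq n]
    {M : Matrix n n ℝ} {i j : n} (hij : i ≠ j) {s t : ℝ} (hs : s ≠ 0)
    (h : ∀ k, s * M i k = t * M j k) : M.det = 0 := by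
  rw [← Matrix.exists_vecMul_eq_zero_iff]
  refine ⟨Pi.single i s - Pi.single j t, fun hx => ?_, ?_⟩
  · have := congrFun hx i
    simp [hij, hs] at this
  · ext k
    simp [Matrix.sub_vecMul, h k]

/-- With two adjacent vertices of minimal eccentricity, the rows fall into four classes of
proportional rows. -/
theorem eccMatrix_det_eq_zero_of_two_centers [Fintype V] [DecidableEq V] {G : SimpleGraph V}
    (hG : G.IsTree) (hn : 5 ≤ Fintype.card V) {x y : V} (hxy : G.Adj x y)
    (h_ecc : ecc G x = ecc G y) : (eccMatrix G).det = 0 := by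
  classical
  set r := ecc G x with hrdef
  have h_one := dist_eq_one_iff_adj.2 hxy
  have hr : 1 ≤ r := h_one ▸ dist_le_ecc G x y
  have key (p q : V) (hpq : G.Adj p q) (hp : ecc G p = r) (hq : ecc G q = r) (u : V)
      (hu : G.dist u q = G.dist u p + 1) :
      ecc G u = G.dist u p + r ∧ G.dist u p + 1 ≤ r := by
    have hle := dist_le_ecc G q u
    have hqu : G.dist q u = G.dist u q := dist_comm
    refine ⟨le_antisymm ?_ ?_, by omega⟩
    · obtain ⟨w, hw⟩ := exists_dist_eq_ecc G u
      have h1 := hG.connected.dist_triangle (u := u) (v := p) (w := w)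
      have h2 := dist_le_ecc G p w
      omega
    · obtain ⟨w, hw⟩ := exists_dist_eq_ecc G p
      have h1 := dist_le_ecc G q w
      have h2 : G.dist w p = G.dist p w := dist_comm
      have h3 : G.dist w q = G.dist q w := dist_comm
      have h4 := dist_le_ecc G u w
      rcases hG.dist_eq_dist_add_one_of_adj w hpq with h | h
      · have := hG.dist_eq_add_of_opposite_sides hpq hu h
        omega
      · omega
  have proportional (p q : V) (hpq : G.Adj p q) (hp : ecc G p = r) (hq : ecc G q = r) (u u' : V)
      (hu : G.dist u q = G.dist u p + 1) (hu' : G.dist u' q = G.dist u' p + 1)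
      (hclass : G.dist u p + 1 = r ↔ G.dist u' p + 1 = r) (w : V) :
      ((G.dist u' p + r : ℕ) : ℝ) * eccMatrix G u w =
        ((G.dist u p + r : ℕ) : ℝ) * eccMatrix G u' w := by
    obtain ⟨he, hle⟩ := key p q hpq hp hq u hu
    obtain ⟨he', hle'⟩ := key p q hpq hp hq u' hu'
    simp only [eccMatrix, Matrix.of_apply]
    rcases hG.dist_eq_dist_add_one_of_adj w hpq with hw | hw
    · obtain ⟨hew, hlew⟩ := key q p hpq.symm hq hp w hw
      have h1 := hG.dist_eq_add_of_opposite_sides hpq hu hw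
      have h2 := hG.dist_eq_add_of_opposite_sides hpq hu' hw
      have h3 : G.dist w q = G.dist q w := dist_comm
      rw [he, he', hew]
      by_cases hc : G.dist u p + 1 = r
      · have hc' := hclass.1 hc
        have : G.dist u p = G.dist u' p := by omega
        rw [h1, h2, this]
      · have hc' := mt hclass.2 hc
        by_cases hcw : G.dist w q + 1 = r
        · rw [if_pos (by omega), if_pos (by omega)]
          have h4 : G.dist u w = G.dist u p + r := by omega
          have h5 : G.dist u' w = G.dist u' p + r := by omega
          rw [h4, h5]
          ring
        · rw [if_neg (by omega), if_neg (by omega)]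
          simp
    · obtain ⟨hew, hlew⟩ := key p q hpq hp hq w hw
      have h1 := hG.connected.dist_triangle (u := u) (v := p) (w := w)
      have h2 := hG.connected.dist_triangle (u := u') (v := p) (w := w)
      have h3 : G.dist w p = G.dist p w := dist_comm
      rw [if_neg (by omega), if_neg (by omega)]
      simp
  obtain ⟨u, u', hne, hclass⟩ := Fintype.exists_ne_map_eq_of_card_lt
    (fun u => (decide (G.dist u y = G.dist u x + 1),
      decide (min (G.dist u x) (G.dist u y) + 1 = r))) (by simp; omega)
  simp only [Prod.mk.injEq, decide_eq_decide] at hclass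
  obtain ⟨hside, hdepth⟩ := hclass
  have hu := hG.dist_eq_dist_add_one_of_adj u hxy
  have hu' := hG.dist_eq_dist_add_one_of_adj u' hxy
  by_cases h : G.dist u y = G.dist u x + 1
  · have h' := hside.1 h
    exact Matrix.det_eq_zero_of_smul_row_eq hne (Nat.cast_ne_zero.2 (by omega))
      (proportional x y hxy rfl h_ecc.symm u u' h h' (by omega))
  · have h1 := hu.resolve_right h
    have h2 := hu'.resolve_right (mt hside.2 h)
    exact Matrix.det_eq_zero_of_smul_row_eq hne (Nat.cast_ne_zero.2 (by omega))
      (proportional y x hxy.symm h_ecc.symm rfl u u' h1 h2 (by omega))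

/-- A tree on at least 5 vertices which is not a star has a singular
eccentricity matrix.  (A tree is a star iff some vertex is adjacent to all others.) -/
theorem eccMatrix_det_eq_zero_of_tree_not_star [Fintype V] [DecidableEq V]
    (T : SimpleGraph V) (hT : T.IsTree) (hn : 5 ≤ Fintype.card V)
    (hstar : ¬ ∃ c : V, ∀ v : V, v ≠ c → T.Adj c v) :
    (eccMatrix T).det = 0 := by
  have := hT.connected.nonempty
  obtain ⟨c, hc⟩ := Finite.exists_min (ecc T)
  by_cases huniq : ∃ c', c' ≠ c ∧ ecc T c' = ecc T c
  · obtain ⟨c', hne, he⟩ := huniq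
    exact eccMatrix_det_eq_zero_of_two_centers hT hn
      (adj_of_ecc_minimal hT hne (fun v => he ▸ hc v) hc) he
  · push Not at huniq
    refine eccMatrix_det_eq_zero_of_unique_center hT (c := c) ?_
      fun v hv => lt_of_le_of_ne (hc v) (huniq v hv).symm
    by_contra! hlt
    refine hstar ⟨c, fun v hv => dist_eq_one_iff_adj.1 ?_⟩
    have h1 := dist_le_ecc T c v
    have h2 := hT.connected.pos_dist_of_ne hv.symm
    omega
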